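/- Let Λ be P-complete and let F = (F_t) be a filtration satisfying the usual conditions with P(F) ⊂ Λ ⊂ O(F). Then, for every bounded Λ-measurable process C and every totally Λ-inaccessible F-stopping time T, one has C_T = (^P C)_T P-almost surely, where ^P C denotes the F-predictable projection of C. -/

import Mathlib

open MeasureTheory Filter Set Topology
open scoped NNReal ENNReal symmDiff Classical

noncomputable section

namespace Meyer

variable {Ω : Type*}

/-- The σ-field generated by a family of real-valued functions. -/
def genBy {α : Type*} (C : Set (α → ℝ)) : MeasurableSpace α :=
  ⨆ f ∈ C, MeasurableSpace.comap f inferInstance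

/-- A function is càdlàg: right-continuous with left limits. -/
def IsCadlag (f : ℝ≥0 → ℝ) : Prop :=
  (∀ t, Tendsto f (𝓝[≥] t) (𝓝 (f t))) ∧
  ∀ t : ℝ≥0, 0 < t → ∃ l, Tendsto f (𝓝[<] t) (𝓝 l)

/-- A Meyer-σ-field over `(Ω, mΩ)`: a σ-field on `Ω × [0,∞)` contained in the product
σ-field, generated by càdlàg processes, containing `{∅,Ω} × B([0,∞))` and stable under
stopping at deterministic times. -/
structure IsMeyer (mΩ : MeasurableSpace Ω) (Λ : MeasurableSpace (Ω × ℝ≥0)) : Prop where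
  le_prod : Λ ≤ @Prod.instMeasurableSpace Ω ℝ≥0 mΩ inferInstance
  gen_cadlag : ∃ C : Set (Ω × ℝ≥0 → ℝ),
    (∀ Z ∈ C, ∀ ω, IsCadlag fun t => Z (ω, t)) ∧ Λ = genBy C
  contains_borel : ∀ B : Set ℝ≥0, MeasurableSet B → MeasurableSet[Λ] (Set.univ ×ˢ B)
  stop_stable : ∀ Z : Ω × ℝ≥0 → ℝ, Measurable[Λ] Z → ∀ s : ℝ≥0,
    Measurable[Λ] fun p => Z (p.1, min p.2 s)

/-- A `Λ`-stopping time: `[[S,∞[[ ∈ Λ`. -/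
def IsStoppingTimeM (Λ : MeasurableSpace (Ω × ℝ≥0)) (S : Ω → ℝ≥0∞) : Prop :=
  MeasurableSet[Λ] {p : Ω × ℝ≥0 | S p.1 ≤ (p.2 : ℝ≥0∞)}

/-- The associated filtration `F^Λ_t := σ(Z_t : Z Λ-measurable)`. -/
def sigmaAt (Λ : MeasurableSpace (Ω × ℝ≥0)) (t : ℝ≥0) : MeasurableSpace Ω :=
  genBy {f : Ω → ℝ | ∃ Z : Ω × ℝ≥0 → ℝ, Measurable[Λ] Z ∧ f = fun ω => Z (ω, t)}

/-- `F^Λ_∞`. -/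
def sigmaInf (Λ : MeasurableSpace (Ω × ℝ≥0)) : MeasurableSpace Ω := ⨆ t : ℝ≥0, sigmaAt Λ t

/-- A process indexed by `[0,∞]` is `Λ`-measurable if its restriction to `Ω × [0,∞)`
is `Λ`-measurable and its value at `∞` is `F^Λ_∞`-measurable. -/
def MeasurableProcessE (Λ : MeasurableSpace (Ω × ℝ≥0)) (Z : Ω × ℝ≥0∞ → ℝ) : Prop :=
  Measurable[Λ] (fun p : Ω × ℝ≥0 => Z (p.1, (p.2 : ℝ≥0∞))) ∧
  Measurable[sigmaInf Λ] fun ω => Z (ω, ∞)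

/-- `F^Λ_S := σ(Z_S : Z a Λ-measurable process on [0,∞])`. -/
def sigmaAtTime (Λ : MeasurableSpace (Ω × ℝ≥0)) (S : Ω → ℝ≥0∞) : MeasurableSpace Ω :=
  genBy {f : Ω → ℝ | ∃ Z : Ω × ℝ≥0∞ → ℝ, MeasurableProcessE Λ Z ∧ f = fun ω => Z (ω, S ω)}

/-- `S_A`: equal to `S` on `A` and `∞` off `A`. -/
def restrictST (S : Ω → ℝ≥0∞) (A : Set Ω) : Ω → ℝ≥0∞ := fun ω => if ω ∈ A then S ω else ∞

/-- Evaluation of a process indexed by `[0,∞]` at a random time. -/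
def EvalAt (Z : Ω × ℝ≥0∞ → ℝ) (S : Ω → ℝ≥0∞) : Ω → ℝ := fun ω => Z (ω, S ω)

/-- Evaluation of a process indexed by `[0,∞)` at a (finite) random time. -/
def EvalAtF (Z : Ω × ℝ≥0 → ℝ) (S : Ω → ℝ≥0∞) : Ω → ℝ := fun ω => Z (ω, (S ω).toNNReal)

/-- Adaptedness of a process to a raw filtration. -/
def Adapted' (G : ℝ≥0 → MeasurableSpace Ω) (Z : Ω × ℝ≥0 → ℝ) : Prop :=
  ∀ t, Measurable[G t] fun ω => Z (ω, t)

/-- Predictable σ-field of a filtration: generated by continuous adapted processes. -/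
def predSF (G : ℝ≥0 → MeasurableSpace Ω) : MeasurableSpace (Ω × ℝ≥0) :=
  genBy {Z | (∀ ω, Continuous fun t => Z (ω, t)) ∧ Adapted' G Z}

/-- Optional σ-field of a filtration: generated by càdlàg adapted processes. -/
def optSF (G : ℝ≥0 → MeasurableSpace Ω) : MeasurableSpace (Ω × ℝ≥0) :=
  genBy {Z | (∀ ω, IsCadlag fun t => Z (ω, t)) ∧ Adapted' G Z}

/-- Classical stopping time of a raw filtration. -/
def IsStoppingTimeCl (G : ℝ≥0 → MeasurableSpace Ω) (T : Ω → ℝ≥0∞) : Prop :=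
  ∀ t : ℝ≥0, MeasurableSet[G t] {ω | T ω ≤ (t : ℝ≥0∞)}

/-- The right-continuous filtration `F^Λ_{t+}`. -/
def FplusLambda (Λ : MeasurableSpace (Ω × ℝ≥0)) (t : ℝ≥0) : MeasurableSpace Ω :=
  ⨅ (s : ℝ≥0) (_ : t < s), sigmaAt Λ s

/-- Two processes are indistinguishable. -/
def Indistinguishable {τ : Type*} [MeasurableSpace Ω] (P : Measure Ω)
    (X Y : Ω × τ → ℝ) : Prop :=
  P {ω | ∃ t, X (ω, t) ≠ Y (ω, t)} = 0

/-- `Λ` is `P`-complete: every product-measurable process indistinguishable from a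
`Λ`-measurable process is itself `Λ`-measurable. -/
def IsPCompleteM [mΩ : MeasurableSpace Ω] (P : Measure Ω)
    (Λ : MeasurableSpace (Ω × ℝ≥0)) : Prop :=
  ∀ Z Z' : Ω × ℝ≥0 → ℝ, Measurable Z → Measurable[Λ] Z' →
    Indistinguishable P Z Z' → Measurable[Λ] Z

/-- A raw filtration satisfies the usual conditions: monotone, sub-σ-fields of `mΩ`,
right-continuous and `P`-complete. -/
def UsualConditions [mΩ : MeasurableSpace Ω] (P : Measure Ω)
    (G : ℝ≥0 → MeasurableSpace Ω) : Prop :=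
  Monotone G ∧ (∀ t, G t ≤ mΩ) ∧
  (∀ t : ℝ≥0, G t = ⨅ (s : ℝ≥0) (_ : t < s), G s) ∧
  ∀ N : Set Ω, MeasurableSet N → P N = 0 → MeasurableSet[G 0] N

variable [mΩ : MeasurableSpace Ω]

/-- `Λ`-martingale (indexed by `[0,∞]`). -/
def IsMartingaleM (P : Measure Ω) (Λ : MeasurableSpace (Ω × ℝ≥0))
    (Z : Ω × ℝ≥0∞ → ℝ) : Prop :=
  MeasurableProcessE Λ Z ∧
  (∀ S, IsStoppingTimeM Λ S → Integrable (EvalAt Z S) P) ∧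
  ∀ S T : Ω → ℝ≥0∞, IsStoppingTimeM Λ S → IsStoppingTimeM Λ T → S ≤ T →
    EvalAt Z S =ᵐ[P] P[EvalAt Z T|sigmaAtTime Λ S]

/-- `Λ`-supermartingale (indexed by `[0,∞]`). -/
def IsSupermartingaleM (P : Measure Ω) (Λ : MeasurableSpace (Ω × ℝ≥0))
    (Z : Ω × ℝ≥0∞ → ℝ) : Prop :=
  MeasurableProcessE Λ Z ∧
  (∀ S, IsStoppingTimeM Λ S → Integrable (EvalAt Z S) P) ∧
  ∀ S T : Ω → ℝ≥0∞, IsStoppingTimeM Λ S → IsStoppingTimeM Λ T → S ≤ T →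
    P[EvalAt Z T|sigmaAtTime Λ S] ≤ᵐ[P] EvalAt Z S

/-- Class `(D^Λ)` for a process: uniform integrability of `{Z_T : T ∈ S^Λ}`. -/
def ClassD (P : Measure Ω) (Λ : MeasurableSpace (Ω × ℝ≥0)) (Z : Ω × ℝ≥0∞ → ℝ) : Prop :=
  UniformIntegrable (fun S : {S : Ω → ℝ≥0∞ // IsStoppingTimeM Λ S} => EvalAt Z S.1) 1 P

/-- Class `(D^Λ)` for a system. -/
def ClassDSys (P : Measure Ω) (Λ : MeasurableSpace (Ω × ℝ≥0))
    (ZS : (Ω → ℝ≥0∞) → Ω → ℝ) : Prop :=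
  UniformIntegrable (fun S : {S : Ω → ℝ≥0∞ // IsStoppingTimeM Λ S} => ZS S.1) 1 P

/-- `pY` is a `Λ`-projection of `Y` (processes indexed by `[0,∞]`). -/
def IsProjectionE (P : Measure Ω) (Λ : MeasurableSpace (Ω × ℝ≥0))
    (Y pY : Ω × ℝ≥0∞ → ℝ) : Prop :=
  MeasurableProcessE Λ pY ∧
  ∀ S, IsStoppingTimeM Λ S → (∀ ω, S ω < ∞) →
    EvalAt pY S =ᵐ[P] P[EvalAt Y S|sigmaAtTime Λ S]

/-- `pY` is a `Λ`-projection of `Y` (processes indexed by `[0,∞)`). -/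
def IsProjectionF (P : Measure Ω) (Λ : MeasurableSpace (Ω × ℝ≥0))
    (Y pY : Ω × ℝ≥0 → ℝ) : Prop :=
  Measurable[Λ] pY ∧
  ∀ S, IsStoppingTimeM Λ S → (∀ ω, S ω < ∞) →
    EvalAtF pY S =ᵐ[P] P[EvalAtF Y S|sigmaAtTime Λ S]

/-- Right-upper-semicontinuous envelope `Z^*` (with `Z^*_∞ := Z_∞`). -/
def rightLimsup (Z : Ω × ℝ≥0∞ → ℝ) (ω : Ω) (t : ℝ≥0∞) : ℝ :=
  if t = ∞ then Z (ω, ∞)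
  else limsup (fun s : ℝ≥0 => Z (ω, (s : ℝ≥0∞))) (𝓝[>] t.toNNReal)

/-- Right-lower-semicontinuous envelope `Z_*` (with `Z_{∞*} := Z_∞`). -/
def rightLiminf (Z : Ω × ℝ≥0∞ → ℝ) (ω : Ω) (t : ℝ≥0∞) : ℝ :=
  if t = ∞ then Z (ω, ∞)
  else liminf (fun s : ℝ≥0 => Z (ω, (s : ℝ≥0∞))) (𝓝[>] t.toNNReal)

/-- Left-upper-semicontinuous envelope `*Z` (with `*Z_0 := Z_0` and
`*Z_∞ := limsup_{t↑∞} Z_t`). -/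
def leftLimsup (Z : Ω × ℝ≥0∞ → ℝ) (ω : Ω) (t : ℝ≥0∞) : ℝ :=
  if t = 0 then Z (ω, 0)
  else if t = ∞ then limsup (fun s : ℝ≥0 => Z (ω, (s : ℝ≥0∞))) atTop
  else limsup (fun s : ℝ≥0 => Z (ω, (s : ℝ≥0∞))) (𝓝[<] t.toNNReal)

/-- Left-lower-semicontinuous envelope `_*Z`. -/
def leftLiminf (Z : Ω × ℝ≥0∞ → ℝ) (ω : Ω) (t : ℝ≥0∞) : ℝ :=
  if t = 0 then Z (ω, 0)
  else if t = ∞ then liminf (fun s : ℝ≥0 => Z (ω, (s : ℝ≥0∞))) atTop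
  else liminf (fun s : ℝ≥0 => Z (ω, (s : ℝ≥0∞))) (𝓝[<] t.toNNReal)

/-- `T` is `Λ`-accessible. -/
def IsAccessibleM [mΩ2 : MeasurableSpace Ω] (P : Measure Ω)
    (Λ : MeasurableSpace (Ω × ℝ≥0)) (T : Ω → ℝ≥0∞) : Prop :=
  ∃ Tn : ℕ → Ω → ℝ≥0∞, (∀ n, IsStoppingTimeM Λ (Tn n)) ∧
    P (⋃ n, {ω | Tn n ω = T ω ∧ T ω < ∞}) = P {ω | T ω < ∞}

/-- `T` is totally `Λ`-inaccessible. -/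
def IsTotallyInaccessibleM [mΩ2 : MeasurableSpace Ω] (P : Measure Ω)
    (Λ : MeasurableSpace (Ω × ℝ≥0)) (T : Ω → ℝ≥0∞) : Prop :=
  ∀ S, IsStoppingTimeM Λ S → P {ω | S ω = T ω ∧ T ω < ∞} = 0

/-- The σ-field `G_{T-}`: generated by `G_0` and the sets `A ∩ {t < T}`, `A ∈ G_t`. -/
def sigmaPre (G : ℝ≥0 → MeasurableSpace Ω) (T : Ω → ℝ≥0∞) : MeasurableSpace Ω :=
  MeasurableSpace.generateFrom
    ({A | MeasurableSet[G 0] A} ∪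
      {A | ∃ (t : ℝ≥0) (B : Set Ω), MeasurableSet[G t] B ∧ A = B ∩ {ω | (t : ℝ≥0∞) < T ω}})

/-- The σ-field `G_T` of a classical stopping time `T`. -/
def sigmaAtCl (G : ℝ≥0 → MeasurableSpace Ω) (T : Ω → ℝ≥0∞) : MeasurableSpace Ω :=
  MeasurableSpace.generateFrom
    {A | ∀ t : ℝ≥0, MeasurableSet[G t] (A ∩ {ω | T ω ≤ (t : ℝ≥0∞)})}

/-- A divided stopping time `σ = (T, W⁻, W, W⁺)`. -/
structure IsDividedST (Λ : MeasurableSpace (Ω × ℝ≥0)) (T : Ω → ℝ≥0∞)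
    (Wm W Wp : Set Ω) : Prop where
  stopping : IsStoppingTimeCl (FplusLambda Λ) T
  cover : Wm ∪ W ∪ Wp = Set.univ
  disj_mw : Wm ∩ W = ∅
  disj_mp : Wm ∩ Wp = ∅
  disj_wp : W ∩ Wp = ∅
  mem_m : MeasurableSet[sigmaPre (FplusLambda Λ) T] Wm
  m_pos : Wm ∩ {ω | T ω = 0} = ∅
  mem_w : MeasurableSet[sigmaAtTime Λ T] W
  mem_p : MeasurableSet[sigmaAtCl (FplusLambda Λ) T] Wp
  p_fin : Wp ∩ {ω | T ω = ∞} = ∅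
  pred_m : IsStoppingTimeM (predSF (FplusLambda Λ)) (restrictST T Wm)
  st_w : IsStoppingTimeM Λ (restrictST T W)

/-- The value `Z_σ` of a process at a divided stopping time. -/
def divEval (Z : Ω × ℝ≥0∞ → ℝ) (T : Ω → ℝ≥0∞) (Wm W Wp : Set Ω) : Ω → ℝ := fun ω =>
  if ω ∈ Wm then leftLimsup Z ω (T ω)
  else if ω ∈ W then Z (ω, T ω)
  else rightLimsup Z ω (T ω)

/-- `Zb` is the `Λ`-Snell envelope of the system `ZS`: a `Λ`-supermartingale which at
each `Λ`-stopping time `S` is (a version of) `ess sup_{T ∈ S^Λ, T ≥ S} E[Z(T) | F^Λ_S]`. -/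
def IsSnellSys (P : Measure Ω) (Λ : MeasurableSpace (Ω × ℝ≥0))
    (ZS : (Ω → ℝ≥0∞) → Ω → ℝ) (Zb : Ω × ℝ≥0∞ → ℝ) : Prop :=
  IsSupermartingaleM P Λ Zb ∧
  ∀ S, IsStoppingTimeM Λ S →
    (∀ T, IsStoppingTimeM Λ T → S ≤ T →
      P[ZS T|sigmaAtTime Λ S] ≤ᵐ[P] EvalAt Zb S) ∧
    ∀ U : Ω → ℝ,
      (∀ T, IsStoppingTimeM Λ T → S ≤ T → P[ZS T|sigmaAtTime Λ S] ≤ᵐ[P] U) →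
      EvalAt Zb S ≤ᵐ[P] U

/-- `Zb` is the `Λ`-Snell envelope of the process `Z`. -/
def IsSnellProc (P : Measure Ω) (Λ : MeasurableSpace (Ω × ℝ≥0))
    (Z Zb : Ω × ℝ≥0∞ → ℝ) : Prop :=
  IsSnellSys P Λ (fun S => EvalAt Z S) Zb

/-- An `S^Λ`-system. -/
def IsSystemM (P : Measure Ω) (Λ : MeasurableSpace (Ω × ℝ≥0))
    (ZS : (Ω → ℝ≥0∞) → Ω → ℝ) : Prop :=
  (∀ S T, IsStoppingTimeM Λ S → IsStoppingTimeM Λ T →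
    ∀ᵐ ω ∂P, S ω = T ω → ZS S ω = ZS T ω) ∧
  ∀ S, IsStoppingTimeM Λ S → Measurable[sigmaAtTime Λ S] (ZS S)

/-- An `S^Λ`-supermartingale system. -/
def IsSupermartingaleSystem (P : Measure Ω) (Λ : MeasurableSpace (Ω × ℝ≥0))
    (ZS : (Ω → ℝ≥0∞) → Ω → ℝ) : Prop :=
  IsSystemM P Λ ZS ∧ (∀ S, IsStoppingTimeM Λ S → Integrable (ZS S) P) ∧
  ∀ S T, IsStoppingTimeM Λ S → IsStoppingTimeM Λ T → S ≤ T →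
    P[ZS T|sigmaAtTime Λ S] ≤ᵐ[P] ZS S

/-- The process `Zb` aggregates the system `ZS`. -/
def Aggregates (P : Measure Ω) (Λ : MeasurableSpace (Ω × ℝ≥0))
    (Zb : Ω × ℝ≥0∞ → ℝ) (ZS : (Ω → ℝ≥0∞) → Ω → ℝ) : Prop :=
  ∀ S, IsStoppingTimeM Λ S → EvalAt Zb S =ᵐ[P] ZS S

/-- `pY` is the `F`-predictable projection of `Y` (with the convention `(^P Y)_∞ = 0`). -/
def IsPredProjE (P : Measure Ω) (G : ℝ≥0 → MeasurableSpace Ω)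
    (Y pY : Ω × ℝ≥0∞ → ℝ) : Prop :=
  MeasurableProcessE (predSF G) pY ∧ (∀ ω, pY (ω, ∞) = 0) ∧
  ∀ S, IsStoppingTimeM (predSF G) S → (∀ ω, S ω < ∞) →
    EvalAt pY S =ᵐ[P] P[EvalAt Y S|sigmaAtTime (predSF G) S]
/-- `pY` is an `F`-predictable projection of `Y` (processes indexed by `[0,∞)`). -/
def IsPredProjF (P : Measure Ω) (G : ℝ≥0 → MeasurableSpace Ω)
    (Y pY : Ω × ℝ≥0 → ℝ) : Prop :=
  Measurable[predSF G] pY ∧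
  ∀ S, IsStoppingTimeM (predSF G) S → (∀ ω, S ω < ∞) →
    EvalAtF pY S =ᵐ[P] P[EvalAtF Y S|sigmaAtTime (predSF G) S]


/-! ### Helper lemmas -/

set_option linter.unusedVariables false
set_option linter.unusedSectionVars false

theorem genBy_meas {α : Type*} {C : Set (α → ℝ)} {Z : α → ℝ} (hZ : Z ∈ C) :
    Measurable[genBy C] Z := by
  rw [measurable_iff_comap_le]
  exact le_iSup₂_of_le (f := fun (f : α → ℝ) (_ : f ∈ C) =>
    MeasurableSpace.comap f inferInstance) Z hZ le_rfl

theorem meas_genBy {α β : Type*} {C : Set (α → ℝ)} {m : MeasurableSpace β} {f : β → α}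
    (h : ∀ Z ∈ C, Measurable[m] (fun b => Z (f b))) : @Measurable _ _ m (genBy C) f := by
  rw [measurable_iff_le_map]
  refine iSup₂_le fun Z hZ => ?_
  rw [MeasurableSpace.comap_le_iff_le_map]
  exact (measurable_iff_le_map.1 (h Z hZ))

theorem sect_pred {X : Type*} (G : ℝ≥0 → MeasurableSpace X) (t : ℝ≥0) :
    @Measurable _ _ (G t) (predSF G) (fun ω => (ω, t)) :=
  meas_genBy fun _ hZ => hZ.2 t

theorem sect_opt {X : Type*} (G : ℝ≥0 → MeasurableSpace X) (t : ℝ≥0) :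
    @Measurable _ _ (G t) (optSF G) (fun ω => (ω, t)) :=
  meas_genBy fun _ hZ => hZ.2 t

/-- continuous adapted process -/
def CA {X : Type*} (G : ℝ≥0 → MeasurableSpace X) (Z : X × ℝ≥0 → ℝ) : Prop :=
  (∀ ω, Continuous fun t => Z (ω, t)) ∧ Adapted' G Z

theorem CA.meas {X : Type*} {G : ℝ≥0 → MeasurableSpace X} {Z : X × ℝ≥0 → ℝ} (h : CA G Z) :
    Measurable[predSF G] Z := genBy_meas h

def dsq : ℕ → ℝ≥0 := TopologicalSpace.denseSeq ℝ≥0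

theorem dsq_btwn {a b : ℝ≥0} (h : a < b) : ∃ n, a < dsq n ∧ dsq n < b := by
  obtain ⟨_, ⟨n, rfl⟩, h1, h2⟩ := (TopologicalSpace.denseRange_denseSeq ℝ≥0).exists_between h
  exact ⟨n, h1, h2⟩

theorem snd_pred {X : Type*} (G : ℝ≥0 → MeasurableSpace X) :
    @Measurable _ _ (predSF G) _ (fun p : X × ℝ≥0 => p.2) := by
  have h : CA G (fun p : X × ℝ≥0 => (p.2 : ℝ)) :=
    ⟨fun ω => NNReal.continuous_coe, fun t => by
      dsimp only; exact @measurable_const _ _ _ (G t) _⟩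
  have := h.meas
  have h2 := measurable_real_toNNReal.comp this
  convert h2 using 1
  ext p; simp

theorem rect_pred {X : Type*} {G : ℝ≥0 → MeasurableSpace X} (hG : Monotone G) (s : ℝ≥0) {B : Set X}
    (hB : MeasurableSet[G s] B) :
    MeasurableSet[predSF G] {p : X × ℝ≥0 | p.1 ∈ B ∧ s < p.2} := by
  have h : CA G (fun p : X × ℝ≥0 => B.indicator (fun _ => (1:ℝ)) p.1 * ((p.2 - s : ℝ≥0) : ℝ)) := by
    refine ⟨fun ω => ?_, fun t => ?_⟩
    · dsimp only
      exact continuous_const.mul (NNReal.continuous_coe.comp (by fun_prop))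
    · rcases le_total t s with hts | hts
      · simp only [tsub_eq_zero_of_le hts]
        simp only [NNReal.coe_zero, mul_zero]
        exact @measurable_const _ _ _ (G t) _
      · dsimp only
        refine Measurable.mul_const (f := fun ω => B.indicator (fun _ => (1:ℝ)) ω) ?_ _
        exact (@measurable_const _ _ _ (G t) _).indicator (hG hts _ hB)
  have h3 : MeasurableSet[predSF G] ((fun p : X × ℝ≥0 => B.indicator (fun _ => (1:ℝ)) p.1 * ((p.2 - s : ℝ≥0) : ℝ)) ⁻¹' {0}ᶜ) :=
    h.meas (measurableSet_singleton _).compl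
  convert h3 using 1
  ext p
  simp [Set.indicator_apply, tsub_eq_zero_iff_le]

theorem rect0_pred {X : Type*} {G : ℝ≥0 → MeasurableSpace X} (hG : Monotone G) {B : Set X}
    (hB : MeasurableSet[G 0] B) :
    MeasurableSet[predSF G] {p : X × ℝ≥0 | p.1 ∈ B} := by
  have h : CA G (fun p : X × ℝ≥0 => B.indicator (fun _ => (1:ℝ)) p.1) := by
    refine ⟨fun ω => by dsimp only; exact continuous_const, fun t => ?_⟩
    exact (@measurable_const _ _ _ (G t) _).indicator (hG (zero_le) _ hB)
  have h3 : MeasurableSet[predSF G] ((fun p : X × ℝ≥0 => B.indicator (fun _ => (1:ℝ)) p.1) ⁻¹' {0}ᶜ) :=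
    h.meas (measurableSet_singleton _).compl
  convert h3 using 1
  ext p
  simp [Set.indicator_apply]

/-- Strict stochastic interval. -/
theorem open_int_pred {X : Type*} {G : ℝ≥0 → MeasurableSpace X} (hG : Monotone G) {R : X → ℝ≥0∞}
    (hR : ∀ n, MeasurableSet[G (dsq n)] {ω | R ω < dsq n}) :
    MeasurableSet[predSF G] {p : X × ℝ≥0 | R p.1 < p.2} := by
  have : {p : X × ℝ≥0 | R p.1 < p.2} =
      ⋃ n, {p : X × ℝ≥0 | p.1 ∈ {ω | R ω < dsq n} ∧ dsq n < p.2} := by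
    ext p
    simp only [mem_ofPred_eq, mem_iUnion]
    constructor
    · intro h
      have hr := ENNReal.coe_toNNReal (ne_top_of_lt h)
      rw [← hr] at h ⊢
      obtain ⟨n, h1, h2⟩ := dsq_btwn (ENNReal.coe_lt_coe.1 h)
      exact ⟨n, ENNReal.coe_lt_coe.2 h1, h2⟩
    · rintro ⟨n, h1, h2⟩
      exact h1.trans (ENNReal.coe_lt_coe.2 h2)
  rw [this]
  exact MeasurableSet.iUnion fun n => rect_pred hG _ (hR n)

theorem graph_pred {X : Type*} {G : ℝ≥0 → MeasurableSpace X} (hG : Monotone G) {R : X → ℝ≥0∞}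
    (hR : IsStoppingTimeM (predSF G) R) :
    MeasurableSet[predSF G] {p : X × ℝ≥0 | R p.1 = p.2} := by
  have h1 : ∀ n, MeasurableSet[G (dsq n)] {ω | R ω < dsq n} := by
    intro n
    have : {ω | R ω < dsq n} = ⋃ k, {ω | R ω ≤ dsq k ∧ dsq k < dsq n} := by
      ext ω
      simp only [mem_ofPred_eq, mem_iUnion]
      constructor
      · intro h
        have hr := ENNReal.coe_toNNReal (ne_top_of_lt h)
        rw [← hr] at h ⊢
        obtain ⟨k, h1, h2⟩ := dsq_btwn (ENNReal.coe_lt_coe.1 h)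
        exact ⟨k, ENNReal.coe_le_coe.2 h1.le, h2⟩
      · rintro ⟨k, h1, h2⟩
        exact h1.trans_lt (ENNReal.coe_lt_coe.2 h2)
    rw [this]
    refine MeasurableSet.iUnion fun k => ?_
    by_cases hk : dsq k < dsq n
    · simp only [hk, and_true]
      exact hG hk.le _ (sect_pred G (dsq k) hR)
    · simp [hk]
  have : {p : X × ℝ≥0 | R p.1 = p.2} =
      {p : X × ℝ≥0 | R p.1 ≤ p.2} \ {p : X × ℝ≥0 | R p.1 < p.2} := by
    ext p
    simp only [mem_ofPred_eq, Set.mem_sdiff, not_lt]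
    exact le_antisymm_iff
  rw [this]
  exact MeasurableSet.diff hR (open_int_pred hG h1)

/-! zero sets -/

def IsZ {X : Type*} (G : ℝ≥0 → MeasurableSpace X) (K : Set (X × ℝ≥0)) : Prop :=
  ∃ Z, CA G Z ∧ K = {p | Z p = 0}

theorem IsZ.meas {X : Type*} {G : ℝ≥0 → MeasurableSpace X} {K : Set (X × ℝ≥0)} (h : IsZ G K) :
    MeasurableSet[predSF G] K := by
  obtain ⟨Z, hZ, rfl⟩ := h
  exact hZ.meas (measurableSet_singleton 0)

theorem IsZ.union {X : Type*} {G : ℝ≥0 → MeasurableSpace X} {K L : Set (X × ℝ≥0)} (h : IsZ G K)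
    (h' : IsZ G L) : IsZ G (K ∪ L) := by
  obtain ⟨Z, hZ, rfl⟩ := h
  obtain ⟨W, hW, rfl⟩ := h'
  refine ⟨fun p => Z p * W p, ⟨fun ω => (hZ.1 ω).mul (hW.1 ω), fun t => (hZ.2 t).mul (hW.2 t)⟩, ?_⟩
  ext p; simp

theorem isZ_empty {X : Type*} (G : ℝ≥0 → MeasurableSpace X) : IsZ G ∅ :=
  ⟨fun _ => 1, ⟨fun _ => continuous_const, fun t => @measurable_const _ _ _ (G t) _⟩, by simp⟩

theorem isZ_biUnion {X : Type*} {G : ℝ≥0 → MeasurableSpace X} {K : ℕ → Set (X × ℝ≥0)}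
    (h : ∀ n, IsZ G (K n)) (N : ℕ) : IsZ G (⋃ n ∈ Finset.range N, K n) := by
  induction N with
  | zero => simpa using isZ_empty G
  | succ N ih =>
    rw [Finset.range_add_one, Finset.set_biUnion_insert]
    exact (h N).union ih

theorem isZ_iInter {X : Type*} {G : ℝ≥0 → MeasurableSpace X} {K : ℕ → Set (X × ℝ≥0)}
    (h : ∀ n, IsZ G (K n)) : IsZ G (⋂ n, K n) := by
  choose Z hZ hK using h
  have hb : ∀ n p, ‖min |Z n p| 1 * (1/2:ℝ)^n‖ ≤ (1/2:ℝ)^n := by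
    intro n p
    rw [Real.norm_eq_abs, abs_of_nonneg (by positivity)]
    exact mul_le_of_le_one_left (by positivity) (min_le_right _ _)
  have hs : Summable (fun n : ℕ => (1/2:ℝ)^n) := summable_geometric_two
  have hsum : ∀ p, Summable fun n => min |Z n p| 1 * (1/2:ℝ)^n := fun p =>
    hs.of_norm_bounded (fun n => hb n p)
  refine ⟨fun p => ∑' n, min |Z n p| 1 * (1/2:ℝ)^n, ⟨fun ω => ?_, fun t => ?_⟩, ?_⟩
  · refine continuous_tsum (fun n => ?_) hs (fun n t => hb n (ω, t))
    exact (((hZ n).1 ω).abs.min continuous_const).mul continuous_const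
  · have hm : ∀ n, Measurable[G t] fun ω => min |Z n (ω, t)| 1 * (1/2:ℝ)^n := fun n =>
      ((continuous_abs.measurable.comp ((hZ n).2 t)).min measurable_const).mul_const _
    refine @measurable_of_tendsto_metrizable X ℝ (G t) _ _ _ _ ( fun N ω => ∑ n ∈ Finset.range N, min |Z n (ω, t)| 1 * (1/2:ℝ)^n) _ (fun N => ?_) ?_
    · exact Finset.measurable_fun_sum _ fun n _ => hm n
    · rw [tendsto_pi_nhds]
      exact fun ω => (hsum (ω, t)).hasSum.tendsto_sum_nat
  · ext p
    simp only [hK, mem_iInter, mem_ofPred_eq]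
    have := hasSum_zero_iff_of_nonneg (L := .unconditional ℕ) (f := fun n => min |Z n p| 1 * (1/2:ℝ)^n) (fun n => by positivity)
    rw [← (hsum p).hasSum_iff, this, funext_iff]
    refine forall_congr' fun n => ?_
    simp only [Pi.zero_apply, mul_eq_zero]
    constructor
    · intro h; left; simp [h]
    · rintro (h | h)
      · by_contra hne
        have : 0 < min |Z n p| 1 := lt_min (abs_pos.2 hne) one_pos
        linarith
      · exact absurd h (by positivity)

/-- debut of a zero set -/
theorem debut {X : Type*} {G : ℝ≥0 → MeasurableSpace X} (hG : Monotone G) {K : Set (X × ℝ≥0)} (h : IsZ G K) :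
    ∃ S : X → ℝ≥0∞, IsStoppingTimeM (predSF G) S ∧ (∀ ω (t : ℝ≥0), S ω = t → (ω, t) ∈ K) ∧
      ∀ ω t, (ω, t) ∈ K → S ω ≤ t := by
  obtain ⟨Z, hZ, rfl⟩ := h
  have hex : ∀ ω, (∃ t : ℝ≥0, Z (ω, t) = 0) → ∃ t : ℝ≥0, Z (ω, t) = 0 ∧ ∀ s, Z (ω, s) = 0 → t ≤ s := by
    intro ω hne
    have hc : IsClosed {t : ℝ≥0 | Z (ω, t) = 0} := isClosed_eq (hZ.1 ω) continuous_const
    refine ⟨sInf {t : ℝ≥0 | Z (ω, t) = 0}, hc.csInf_mem hne (OrderBot.bddBelow _), fun s hs => csInf_le (OrderBot.bddBelow _) hs⟩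
  choose! τ hτ1 hτ2 using hex
  refine ⟨fun ω => if ∃ t : ℝ≥0, Z (ω, t) = 0 then (τ ω : ℝ≥0∞) else ∞, ?_, ?_, ?_⟩
  · have hm : ∀ n, Measurable[predSF G] fun p : X × ℝ≥0 => Z (p.1, min (dsq n) p.2) := by
      intro n
      have : CA G (fun p : X × ℝ≥0 => Z (p.1, min (dsq n) p.2)) := by
        refine ⟨fun ω => (hZ.1 ω).comp (by fun_prop), fun t => ?_⟩
        exact (hZ.2 (min (dsq n) t)).mono (hG (min_le_right _ _)) le_rfl
      exact this.meas
    have : {p : X × ℝ≥0 | (if ∃ t : ℝ≥0, Z (p.1, t) = 0 then (τ p.1 : ℝ≥0∞) else ∞) ≤ p.2} =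
      ⋂ m : ℕ, ⋃ n, {p : X × ℝ≥0 | |Z (p.1, min (dsq n) p.2)| < 1 / ((m : ℝ) + 1)} := by
      ext ⟨ω, t⟩
      simp only [mem_ofPred_eq, mem_iInter, mem_iUnion]
      constructor
      · intro hle m
        split_ifs at hle with hx
        · have hle' : τ ω ≤ t := by exact_mod_cast hle
          have hc : Continuous fun s => |Z (ω, min s t)| := ((hZ.1 ω).comp (by fun_prop)).abs
          have ho : IsOpen {s | |Z (ω, min s t)| < 1 / ((m : ℝ) + 1)} := isOpen_lt hc continuous_const
          obtain ⟨n, hn⟩ := (TopologicalSpace.denseRange_denseSeq ℝ≥0).exists_mem_open ho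
            ⟨τ ω, by simp only [mem_ofPred_eq, min_eq_left hle', hτ1 ω hx, abs_zero]; positivity⟩
          exact ⟨n, hn⟩
        · simp at hle
      · intro hall
        obtain ⟨s, hs, hmin⟩ := isCompact_Icc.exists_isMinOn (s := Icc 0 t) ⟨0, by simp⟩ (hZ.1 ω).abs.continuousOn
        have h0 : |Z (ω, s)| = 0 := by
          by_contra hne
          have hpos : 0 < |Z (ω, s)| := lt_of_le_of_ne (abs_nonneg _) (Ne.symm hne)
          obtain ⟨m, hm⟩ := exists_nat_one_div_lt hpos
          obtain ⟨n, hn⟩ := hall m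
          have : |Z (ω, s)| ≤ |Z (ω, min (dsq n) t)| := hmin (a := min (dsq n) t) ⟨zero_le, min_le_right _ _⟩
          linarith
        rw [abs_eq_zero] at h0
        rw [if_pos ⟨s, h0⟩]
        exact_mod_cast (hτ2 ω ⟨s, h0⟩ s h0).trans hs.2
    unfold IsStoppingTimeM
    rw [this]
    refine MeasurableSet.iInter fun m => MeasurableSet.iUnion fun n => ?_
    exact (continuous_abs.measurable.comp (hm n)) measurableSet_Iio
  · intro ω t h
    dsimp only at h
    split_ifs at h with hx
    · have : τ ω = t := by exact_mod_cast h
      rw [← this]; exact hτ1 ω hx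
    · simp at h
  · intro ω t h
    have hx : ∃ t : ℝ≥0, Z (ω, t) = 0 := ⟨t, h⟩
    simp only [if_pos hx]
    exact_mod_cast hτ2 ω hx t h

theorem exhaust {X : Type*} [MeasurableSpace X] (P : Measure X) [IsFiniteMeasure P]
    (c : Set (Set X)) (hc : ∀ s ∈ c, MeasurableSet s) (hne : c.Nonempty) :
    ∃ u : ℕ → Set X, (∀ n, u n ∈ c) ∧ ∀ s ∈ c, P (s \ ⋃ n, u n) = 0 := by
  let V : Set ℝ≥0∞ := {x | ∃ u : ℕ → Set X, (∀ n, u n ∈ c) ∧ x = P (⋃ n, u n)}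
  obtain ⟨s0, hs0⟩ := hne
  have hV : V.Nonempty := ⟨_, fun _ => s0, fun _ => hs0, rfl⟩
  obtain ⟨a, -, ha, haV⟩ := exists_seq_tendsto_sSup hV (OrderTop.bddAbove _)
  choose f hf hfa using haV
  let u : ℕ → Set X := fun n => f (Nat.unpair n).1 (Nat.unpair n).2
  have hu : ∀ n, u n ∈ c := fun n => hf _ _
  have hmu : MeasurableSet (⋃ n, u n) := MeasurableSet.iUnion fun n => hc _ (hu n)
  have hle : sSup V ≤ P (⋃ n, u n) := by
    refine le_of_tendsto' ha fun k => ?_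
    rw [hfa k]
    refine measure_mono (iUnion_subset fun j => ?_)
    refine subset_iUnion_of_subset (Nat.pair k j) ?_
    simp [u]
  refine ⟨u, hu, fun s hs => ?_⟩
  have h1 : P (s ∪ ⋃ n, u n) ≤ sSup V := by
    refine le_sSup ⟨fun n => Nat.casesOn n s u, fun n => ?_, ?_⟩
    · cases n with
      | zero => exact hs
      | succ n => exact hu n
    · congr 1
      ext x
      simp only [mem_union, mem_iUnion]
      constructor
      · rintro (h | ⟨n, h⟩)
        · exact ⟨0, h⟩
        · exact ⟨n + 1, h⟩
      · rintro ⟨n, h⟩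
        cases n with
        | zero => exact Or.inl h
        | succ n => exact Or.inr ⟨n, h⟩
  have h2 : s \ (⋃ n, u n) = (s ∪ ⋃ n, u n) \ (⋃ n, u n) := by
    rw [union_sdiff_right]
  rw [h2, measure_sdiff subset_union_right hmu.nullMeasurableSet (measure_ne_top _ _)]
  exact tsub_eq_zero_of_le (h1.trans hle)

theorem approx {X : Type*} {G : ℝ≥0 → MeasurableSpace X} {m : MeasurableSpace (X × ℝ≥0)}
    (hle : predSF G ≤ m) (μ : Measure (X × ℝ≥0)) [IsFiniteMeasure μ] {A : Set (X × ℝ≥0)}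
    (hA : MeasurableSet[predSF G] A) (ε : ℝ≥0∞) (hε : ε ≠ 0) :
    ∃ F U, IsZ G F ∧ IsZ G Uᶜ ∧ F ⊆ A ∧ A ⊆ U ∧ μ (U \ F) ≤ ε := by
  have mz : ∀ {K}, IsZ G K → MeasurableSet K := fun h => hle _ h.meas
  let Q : Set (X × ℝ≥0) → Prop := fun A => ∀ ε : ℝ≥0∞, ε ≠ 0 →
    ∃ F U, IsZ G F ∧ IsZ G Uᶜ ∧ F ⊆ A ∧ A ⊆ U ∧ μ (U \ F) ≤ ε
  let m' : MeasurableSpace (X × ℝ≥0) :=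
    { MeasurableSet' := Q
      measurableSet_empty := by
        intro ε hε
        refine ⟨∅, ∅, isZ_empty G, ?_, le_rfl, le_rfl, by simp⟩
        refine ⟨fun _ => 0, ⟨fun _ => continuous_const, fun t => @measurable_const _ _ _ (G t) _⟩, by simp⟩
      measurableSet_compl := by
        intro s hs ε hε
        obtain ⟨F, U, h1, h2, h3, h4, h5⟩ := hs ε hε
        refine ⟨Uᶜ, Fᶜ, h2, by simpa using h1, compl_subset_compl.2 h4, compl_subset_compl.2 h3, ?_⟩
        convert h5 using 2
        ext x; simp [and_comm]
      measurableSet_iUnion := by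
        intro s hs ε hε
        have hε2 : ε / 2 ≠ 0 := by simpa using hε
        obtain ⟨e, he, hsum⟩ := ENNReal.exists_pos_sum_of_countable' hε2 ℕ
        choose F U h1 h2 h3 h4 h5 using fun n => hs n (e n) (he n).ne'
        have hU : MeasurableSet (⋃ n, U n) :=
          MeasurableSet.iUnion fun n => by simpa using (mz (h2 n)).compl
        have hanti : Antitone fun N => (⋃ n, U n) \ ⋃ n ∈ Finset.range N, F n := by
          intro N M hNM
          refine sdiff_subset_sdiff_right ?_
          exact biUnion_subset_biUnion_left (by simpa using hNM)
        have ht := tendsto_measure_iInter_atTop (μ := μ)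
          (s := fun N => (⋃ n, U n) \ ⋃ n ∈ Finset.range N, F n)
          (fun N => (hU.diff (mz (isZ_biUnion h1 N))).nullMeasurableSet) hanti
          ⟨0, measure_ne_top _ _⟩
        have hlim : μ (⋂ N, ((⋃ n, U n) \ ⋃ n ∈ Finset.range N, F n)) < ε := by
          calc _ ≤ μ (⋃ n, (U n \ F n)) := by
                refine measure_mono fun x hx => ?_
                simp only [mem_iInter, Set.mem_sdiff, mem_iUnion, Finset.mem_range, not_exists] at hx ⊢
                obtain ⟨n, hn⟩ := (hx 0).1
                exact ⟨n, hn, fun h => (hx (n+1)).2 n (by omega) h⟩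
            _ ≤ ∑' n, μ (U n \ F n) := measure_iUnion_le _
            _ ≤ ∑' n, e n := ENNReal.tsum_le_tsum h5
            _ < ε / 2 := hsum
            _ ≤ ε := ENNReal.half_le_self
        obtain ⟨N, hN⟩ := (ht.eventually_lt_const hlim).exists
        refine ⟨_, _, isZ_biUnion h1 N, ?_, ?_, iUnion_mono h4, hN.le⟩
        · rw [compl_iUnion]; exact isZ_iInter h2
        · refine iUnion₂_subset fun n _ => (h3 n).trans (subset_iUnion s n) }
  suffices h : predSF G ≤ m' from h A hA ε hε
  refine iSup₂_le fun Z hZ => ?_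
  rw [← measurable_iff_comap_le]
  refine measurable_of_isClosed fun C hC => ?_
  intro ε hε
  rcases C.eq_empty_or_nonempty with rfl | hne
  · rw [preimage_empty]
    exact m'.measurableSet_empty ε hε
  have hdc : Continuous fun x : ℝ => Metric.infDist x C := Metric.continuous_infDist_pt C
  have hF : IsZ G (Z ⁻¹' C) := by
    refine ⟨fun p => Metric.infDist (Z p) C, ⟨fun ω => hdc.comp (hZ.1 ω), fun t => hdc.measurable.comp (hZ.2 t)⟩, ?_⟩
    ext p
    simp only [mem_preimage, mem_ofPred_eq]
    exact hC.mem_iff_infDist_zero hne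
  have hU : ∀ k : ℕ, IsZ G {p | Metric.infDist (Z p) C < 1 / ((k:ℝ) + 1)}ᶜ := by
    intro k
    have hcc : Continuous fun x : ℝ => max (1 / ((k:ℝ) + 1) - Metric.infDist x C) 0 := by fun_prop
    refine ⟨fun p => max (1 / ((k:ℝ) + 1) - Metric.infDist (Z p) C) 0, ⟨fun ω => hcc.comp (hZ.1 ω), fun t => hcc.measurable.comp (hZ.2 t)⟩, ?_⟩
    ext p
    simp only [mem_compl_iff, mem_ofPred_eq, not_lt, max_eq_right_iff, sub_nonpos]
  have hanti : Antitone fun k : ℕ => {p | Metric.infDist (Z p) C < 1 / ((k:ℝ) + 1)} \ Z ⁻¹' C := by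
    intro k l hkl
    refine sdiff_subset_sdiff_left fun p hp => ?_
    have h1 : Metric.infDist (Z p) C < 1 / ((l:ℝ) + 1) := hp
    exact h1.trans_le (Nat.one_div_le_one_div hkl)
  have ht := tendsto_measure_iInter_atTop (μ := μ)
    (s := fun k : ℕ => {p | Metric.infDist (Z p) C < 1 / ((k:ℝ) + 1)} \ Z ⁻¹' C)
    (fun N => (MeasurableSet.diff (by simpa using (mz (hU N)).compl) (mz hF)).nullMeasurableSet) hanti
    ⟨0, measure_ne_top _ _⟩
  have h0 : (⋂ k : ℕ, {p | Metric.infDist (Z p) C < 1 / ((k:ℝ) + 1)} \ Z ⁻¹' C) = ∅ := by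
    ext p
    simp only [mem_iInter, Set.mem_sdiff, mem_ofPred_eq, mem_preimage, mem_empty_iff_false, iff_false]
    intro h
    have hn := (h 0).2
    rw [hC.mem_iff_infDist_zero hne] at hn
    have hpos : 0 < Metric.infDist (Z p) C := lt_of_le_of_ne Metric.infDist_nonneg (Ne.symm hn)
    obtain ⟨k, hk⟩ := exists_nat_one_div_lt hpos
    exact absurd (h k).1 (not_lt.2 hk.le)
  rw [h0, measure_empty] at ht
  obtain ⟨k, hk⟩ := (ht.eventually_lt_const (pos_iff_ne_zero.2 hε)).exists
  refine ⟨_, _, hF, hU k, le_rfl, ?_, hk.le⟩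
  intro p hp
  have := (hC.mem_iff_infDist_zero hne).1 hp
  simp only [mem_ofPred_eq, this]
  positivity

theorem pred_section {X : Type*} [mX : MeasurableSpace X] (P : Measure X) [IsFiniteMeasure P]
    {G : ℝ≥0 → MeasurableSpace X} (hG : Monotone G)
    (hle : predSF G ≤ @Prod.instMeasurableSpace X ℝ≥0 mX inferInstance)
    {T : X → ℝ≥0∞} (hT : Measurable T) {A : Set (X × ℝ≥0)} (hA : MeasurableSet[predSF G] A)
    (hpos : P {ω | T ω < ∞ ∧ (ω, (T ω).toNNReal) ∈ A} ≠ 0) :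
    ∃ S : X → ℝ≥0∞, IsStoppingTimeM (predSF G) S ∧ (∀ ω (t : ℝ≥0), S ω = t → (ω, t) ∈ A) ∧
      P {ω | S ω < ∞} ≠ 0 := by
  have hφ : Measurable fun ω => (ω, (T ω).toNNReal) := measurable_id.prodMk hT.ennreal_toNNReal
  let μ := (P.restrict {ω | T ω < ∞}).map fun ω => (ω, (T ω).toNNReal)
  have hTf : MeasurableSet {ω | T ω < ∞} := hT measurableSet_Iio
  have hμ : ∀ B, MeasurableSet[predSF G] B → μ B = P {ω | T ω < ∞ ∧ (ω, (T ω).toNNReal) ∈ B} := by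
    intro B hB
    rw [Measure.map_apply hφ (hle _ hB), Measure.restrict_apply (hφ (hle _ hB))]
    congr 1
    ext ω; simp [and_comm]
  rw [← hμ A hA] at hpos
  obtain ⟨F, U, hF, hU, hFA, hAU, hlt⟩ := approx hle μ hA (μ A / 2) (by simpa using hpos)
  have hF0 : μ F ≠ 0 := by
    intro h0
    have : μ A ≤ μ A / 2 := calc
      μ A ≤ μ (U \ F ∪ F) := measure_mono (by rw [sdiff_union_self]; exact hAU.trans subset_union_left)
      _ ≤ μ (U \ F) + μ F := measure_union_le _ _
      _ ≤ μ A / 2 := by rw [h0, add_zero]; exact hlt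
    exact absurd this (not_le.2 (ENNReal.half_lt_self hpos (measure_ne_top _ _)))
  obtain ⟨S, hS1, hS2, hS3⟩ := debut hG hF
  refine ⟨S, hS1, fun ω t h => hFA (hS2 ω t h), fun h0 => hF0 ?_⟩
  rw [hμ F hF.meas]
  refine measure_mono_null (fun ω hω => ?_) h0
  exact (hS3 ω _ hω.2).trans_lt ENNReal.coe_lt_top

theorem leftlim_pred {X : Type*} {G : ℝ≥0 → MeasurableSpace X} (hG : Monotone G)
    {Z : X × ℝ≥0 → ℝ} (hZ : ∀ ω, IsCadlag fun t => Z (ω, t)) (hZa : Adapted' G Z) :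
    ∃ W : X × ℝ≥0 → ℝ, Measurable[predSF G] W ∧ (∀ ω, W (ω, 0) = Z (ω, 0)) ∧
      ∀ ω (t : ℝ≥0), 0 < t → Tendsto (fun s => Z (ω, s)) (𝓝[<] t) (𝓝 (W (ω, t))) := by
  have hl := fun ω => (hZ ω).2
  choose! l hl using hl
  let W : X × ℝ≥0 → ℝ := fun p => if 0 < p.2 then l p.1 p.2 else Z (p.1, 0)
  let e : ℕ → ℝ≥0 → ℝ≥0 := fun n t => ((⌈((n : ℝ≥0) + 1) * t⌉₊ - 1 : ℕ) : ℝ≥0) / ((n : ℝ≥0) + 1)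
  refine ⟨W, ?_, fun ω => by simp [W], fun ω t ht => by simpa [W, ht] using hl ω t ht⟩
  have hm : ∀ n, Measurable[predSF G] fun p : X × ℝ≥0 => Z (p.1, e n p.2) := by
    intro n B hB
    have hset : ((fun p : X × ℝ≥0 => Z (p.1, e n p.2)) ⁻¹' B) = ⋃ k : ℕ,
        ({p : X × ℝ≥0 | p.1 ∈ {ω | Z (ω, (k : ℝ≥0) / ((n : ℝ≥0) + 1)) ∈ B} ∧
          (k = 0 ∨ (k : ℝ≥0) / ((n : ℝ≥0) + 1) < p.2)} ∩
        (fun p : X × ℝ≥0 => p.2) ⁻¹' {t | ⌈((n : ℝ≥0) + 1) * t⌉₊ - 1 = k}) := by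
      ext ⟨ω, t⟩
      simp only [mem_preimage, mem_iUnion, mem_inter_iff, mem_ofPred_eq]
      constructor
      · intro h
        refine ⟨_, ⟨h, ?_⟩, rfl⟩
        rcases Nat.eq_zero_or_pos (⌈((n : ℝ≥0) + 1) * t⌉₊ - 1) with h0 | h0
        · exact Or.inl h0
        · right
          rw [div_lt_iff₀ (by positivity), mul_comm t]
          have h5 : ⌈((n : ℝ≥0) + 1) * t⌉₊ - 1 < ⌈((n : ℝ≥0) + 1) * t⌉₊ := by omega
          exact Nat.lt_ceil.1 h5
      · rintro ⟨k, ⟨h, -⟩, h2⟩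
        simp only [e, h2]
        exact h
    rw [hset]
    refine MeasurableSet.iUnion fun k => MeasurableSet.inter ?_ (snd_pred G ?_)
    · rcases Nat.eq_zero_or_pos k with rfl | hk
      · simp only [Nat.cast_zero, zero_div, true_or, and_true]
        exact rect0_pred hG (hZa 0 hB)
      · simp only [hk.ne', false_or]
        exact rect_pred hG _ (hZa _ hB)
    · have : Measurable fun t : ℝ≥0 => ⌈((n : ℝ≥0) + 1) * t⌉₊ - 1 := by
        have h1 : Measurable fun t : ℝ≥0 => ⌈((n : ℝ≥0) + 1) * t⌉₊ :=
          Nat.measurable_ceil.comp (measurable_const.mul measurable_id)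
        exact (measurable_from_top (f := fun j : ℕ => j - 1)).comp h1
      exact this (measurableSet_singleton k)
  refine @measurable_of_tendsto_metrizable _ ℝ (predSF G) _ _ _ _ _ _ hm ?_
  rw [tendsto_pi_nhds]
  rintro ⟨ω, t⟩
  rcases eq_or_ne t 0 with rfl | ht
  · simp [W, e]
  have ht : 0 < t := pos_iff_ne_zero.2 ht
  have hW : W (ω, t) = l ω t := by simp [W, ht]
  rw [hW]
  refine (hl ω t ht).comp ?_
  have hlt : ∀ n, e n t < t := by
    intro n
    simp only [e]
    rw [div_lt_iff₀ (by positivity), mul_comm t]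
    apply Nat.lt_ceil.1
    have : 0 < ⌈((n : ℝ≥0) + 1) * t⌉₊ := Nat.ceil_pos.2 (by positivity)
    omega
  have hge : ∀ n : ℕ, t - 1 / ((n : ℝ≥0) + 1) ≤ e n t := by
    intro n
    rw [tsub_le_iff_right]
    simp only [e]
    rw [← add_div, le_div_iff₀ (by positivity), mul_comm t]
    refine (Nat.le_ceil _).trans ?_
    have : ⌈((n : ℝ≥0) + 1) * t⌉₊ ≤ ⌈((n : ℝ≥0) + 1) * t⌉₊ - 1 + 1 := by omega
    exact_mod_cast this
  refine tendsto_nhdsWithin_iff.2 ⟨?_, Eventually.of_forall hlt⟩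
  refine tendsto_of_tendsto_of_tendsto_of_le_of_le ?_ tendsto_const_nhds hge (fun n => (hlt n).le)
  have h1 : Tendsto (fun n : ℕ => 1 / ((n : ℝ≥0) + 1)) atTop (𝓝 0) :=
    tendsto_one_div_add_atTop_nhds_zero_nat
  have := (tendsto_const_nhds (x := t)).sub h1
  simpa using this

/-- Countable description of attained first exit before `r`. -/
def Form (q c r : ℝ≥0) (f : ℝ≥0 → ℝ) : Prop :=
  ∃ m a : ℕ, dsq a < r ∧ (∃ b, (q < dsq b ∧ dsq b < dsq a) ∧ (c : ℝ) < f (dsq b)) ∧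
    ∀ b, (q < dsq b ∧ dsq b < dsq a) → ((c : ℝ) + 1 / ((m : ℝ) + 1) ≤ f (dsq b) ∨
      ∀ k, (q < dsq k ∧ dsq k < dsq b) → f (dsq k) ≤ c)

theorem form_iff {q c r : ℝ≥0} {f : ℝ≥0 → ℝ} (hf : ∀ t, Tendsto f (𝓝[≥] t) (𝓝 (f t)))
    (hq : f q ≤ c) :
    (∃ t < r, q < t ∧ (c : ℝ) < f t ∧ ∀ k, (q < dsq k ∧ dsq k < t) → f (dsq k) ≤ c) ↔
      Form q c r f := by
  constructor
  · rintro ⟨t, htr, hqt, hct, hk⟩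
    obtain ⟨m, hm⟩ := exists_nat_one_div_lt (sub_pos.2 hct)
    have hm' : (c : ℝ) + 1 / ((m : ℝ) + 1) < f t := by linarith
    have hev := (hf t).eventually_const_lt hm'
    obtain ⟨u, hu, hu2⟩ := (mem_nhdsGE_iff_exists_Ico_subset' htr).1 hev
    have hu : t < u := hu
    obtain ⟨a, ha1, ha2⟩ := dsq_btwn (lt_min hu htr)
    obtain ⟨b, hb1, hb2⟩ := dsq_btwn ha1
    have hin : ∀ b, t ≤ dsq b → dsq b < dsq a → (c : ℝ) + 1 / ((m : ℝ) + 1) < f (dsq b) :=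
      fun b h1 h2 => hu2 ⟨h1, h2.trans (ha2.trans_le (min_le_left _ _))⟩
    have hpos : (0:ℝ) < 1 / ((m : ℝ) + 1) := by positivity
    refine ⟨m, a, ha2.trans_le (min_le_right _ _), ⟨b, ⟨hqt.trans hb1, hb2⟩, ?_⟩, ?_⟩
    · have := hin b hb1.le hb2; linarith
    · rintro b ⟨h1, h2⟩
      rcases le_or_gt t (dsq b) with h | h
      · exact Or.inl (hin b h h2).le
      · exact Or.inr fun k hk' => hk k ⟨hk'.1, hk'.2.trans h⟩
  · rintro ⟨m, a, har, ⟨b, ⟨hb1, hb2⟩, hb3⟩, hall⟩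
    let V : Set ℝ≥0 := {s | ∃ b, s = dsq b ∧ (q < dsq b ∧ dsq b < dsq a) ∧ (c : ℝ) < f (dsq b)}
    have hV : V.Nonempty := ⟨_, b, rfl, ⟨hb1, hb2⟩, hb3⟩
    have hbd : BddBelow V := OrderBot.bddBelow _
    have hta : sInf V < dsq a := (csInf_le hbd ⟨b, rfl, ⟨hb1, hb2⟩, hb3⟩).trans_lt hb2
    have hqt : q ≤ sInf V := le_csInf hV (by rintro _ ⟨b, rfl, h, -⟩; exact h.1.le)
    have hpos : (0:ℝ) < 1 / ((m : ℝ) + 1) := by positivity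
    have hin : ∀ b, sInf V < dsq b → dsq b < dsq a → (c : ℝ) + 1 / ((m : ℝ) + 1) ≤ f (dsq b) := by
      intro b h1 h2
      rcases hall b ⟨hqt.trans_lt h1, h2⟩ with h | h
      · exact h
      · obtain ⟨_, ⟨k, rfl, hk1, hk2⟩, hlt⟩ := exists_lt_of_csInf_lt hV h1
        exact absurd (h k ⟨hk1.1, hlt⟩) (not_le.2 hk2)
    have hft : (c : ℝ) + 1 / ((m : ℝ) + 1) ≤ f (sInf V) := by
      by_contra hlt
      rw [not_le] at hlt
      have hev := (hf (sInf V)).eventually_lt_const hlt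
      obtain ⟨u, hu, hu2⟩ := (mem_nhdsGE_iff_exists_Ico_subset' hta).1 hev
      have hu : sInf V < u := hu
      obtain ⟨b, h1, h2⟩ := dsq_btwn (lt_min hu hta)
      have h3 : f (dsq b) < _ := hu2 ⟨h1.le, h2.trans_le (min_le_left _ _)⟩
      exact absurd (hin b h1 (h2.trans_le (min_le_right _ _))) (not_le.2 h3)
    refine ⟨sInf V, hta.trans har, lt_of_le_of_ne hqt ?_, by linarith, ?_⟩
    · intro h; rw [← h] at hft; linarith
    · rintro k ⟨h1, h2⟩
      by_contra hlt
      rw [not_le] at hlt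
      exact absurd (csInf_le hbd ⟨k, rfl, ⟨h1, h2.trans hta⟩, hlt⟩) (not_le.2 h2)

theorem form_meas {X : Type*} [MeasurableSpace X] (q c r : ℝ≥0) (f : X → ℝ≥0 → ℝ)
    (hf : ∀ t < r, Measurable fun ω => f ω t) : MeasurableSet {ω | Form q c r (f ω)} := by
  let g : X → ℝ≥0 → ℝ := fun ω t => if t < r then f ω t else 0
  have hg : ∀ t, Measurable fun ω => g ω t := by
    intro t
    by_cases h : t < r
    · simpa [g, h] using hf t h
    · simp [g, h]
  have : ∀ ω, Form q c r (f ω) ↔ Form q c r (g ω) := by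
    intro ω
    have he : ∀ t < r, g ω t = f ω t := fun t h => by simp [g, h]
    unfold Form
    refine exists_congr fun m => exists_congr fun a => and_congr_right fun ha => ?_
    refine and_congr (exists_congr fun b => and_congr_right fun hb => ?_)
      (forall_congr' fun b => imp_congr_right fun hb => ?_)
    · rw [he _ (hb.2.trans ha)]
    · rw [he _ (hb.2.trans ha)]
      refine or_congr Iff.rfl (forall_congr' fun k => imp_congr_right fun hk => ?_)
      rw [he _ (hk.2.trans (hb.2.trans ha))]
  simp only [this]
  have hlt : ∀ t (x : ℝ), Measurable fun ω => x < g ω t := fun t x =>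
    measurableSet_setOfPred.1 (measurableSet_lt measurable_const (hg t))
  have hle : ∀ t (x : ℝ), Measurable fun ω => x ≤ g ω t := fun t x =>
    measurableSet_setOfPred.1 (measurableSet_le measurable_const (hg t))
  have hge : ∀ t (x : ℝ), Measurable fun ω => g ω t ≤ x := fun t x =>
    measurableSet_setOfPred.1 (measurableSet_le (hg t) measurable_const)
  unfold Form
  refine measurableSet_setOfPred.2 ?_
  refine Measurable.exists fun m => Measurable.exists fun a => measurable_const.and (Measurable.and ?_ ?_)
  · exact Measurable.exists fun b => measurable_const.and (hlt _ _)
  · exact Measurable.forall fun b => measurable_const.imp ((hle _ _).or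
      (Measurable.forall fun k => measurable_const.imp (hge _ _)))

theorem graph_stop {X : Type*} {G : ℝ≥0 → MeasurableSpace X} (hG : Monotone G)
    {Λ : MeasurableSpace (X × ℝ≥0)} (h1 : predSF G ≤ Λ) {E : Set (X × ℝ≥0)}
    (hE : MeasurableSet[Λ] E) (huniq : ∀ ω s t, (ω, s) ∈ E → (ω, t) ∈ E → s = t)
    (hm : ∀ n, MeasurableSet[G (dsq n)] {ω | ∃ t < dsq n, (ω, t) ∈ E}) :
    ∃ S : X → ℝ≥0∞, IsStoppingTimeM Λ S ∧ ∀ ω (t : ℝ≥0), (ω, t) ∈ E → S ω = t := by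
  have hex : ∀ ω, (∃ t, (ω, t) ∈ E) → ∃ t, (ω, t) ∈ E := fun _ h => h
  choose! τ hτ using hex
  let S : X → ℝ≥0∞ := fun ω => if ∃ t, (ω, t) ∈ E then (τ ω : ℝ≥0∞) else ∞
  have hS : ∀ ω t, (ω, t) ∈ E → S ω = t := by
    intro ω t h
    have hx : ∃ t, (ω, t) ∈ E := ⟨t, h⟩
    simp only [S, if_pos hx]
    rw [huniq ω _ _ (hτ ω hx) h]
  have hS' : ∀ ω (t : ℝ≥0), S ω = t → (ω, t) ∈ E := by
    intro ω t h
    by_cases hx : ∃ t, (ω, t) ∈ E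
    · simp only [S, if_pos hx] at h
      have : τ ω = t := by exact_mod_cast h
      rw [← this]; exact hτ ω hx
    · simp only [S, if_neg hx] at h
      simp at h
  refine ⟨S, ?_, hS⟩
  have hopen : MeasurableSet[predSF G] {p : X × ℝ≥0 | S p.1 < p.2} := by
    refine open_int_pred hG fun n => ?_
    convert hm n using 1
    ext ω
    simp only [mem_ofPred_eq]
    constructor
    · intro h
      have hr := ENNReal.coe_toNNReal (ne_top_of_lt h)
      refine ⟨(S ω).toNNReal, ?_, hS' ω _ hr.symm⟩
      rw [← hr] at h
      exact_mod_cast h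
    · rintro ⟨t, ht, hE⟩
      rw [hS ω t hE]
      exact_mod_cast ht
  have : {p : X × ℝ≥0 | S p.1 ≤ p.2} = E ∪ {p : X × ℝ≥0 | S p.1 < p.2} := by
    ext ⟨ω, t⟩
    simp only [mem_ofPred_eq, mem_union]
    rw [le_iff_lt_or_eq, or_comm]
    exact or_congr ⟨hS' ω t, hS ω t⟩ Iff.rfl
  unfold IsStoppingTimeM
  rw [this]
  exact MeasurableSet.union hE (h1 _ hopen)

/-- first exit times -/
theorem exit_stop {X : Type*} {G : ℝ≥0 → MeasurableSpace X} (hG : Monotone G)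
    {Λ : MeasurableSpace (X × ℝ≥0)} (h1 : predSF G ≤ Λ)
    {Z : X × ℝ≥0 → ℝ} (hZ : ∀ ω, IsCadlag fun t => Z (ω, t)) (hZa : Adapted' G Z)
    (hZm : Measurable[Λ] Z) (q c : ℝ≥0) :
    ∃ S : X → ℝ≥0∞, IsStoppingTimeM Λ S ∧ ∀ ω (t : ℝ≥0), q < t → (c : ℝ) < |Z (ω, t) - Z (ω, q)| →
      (∀ s, q < s → s < t → |Z (ω, s) - Z (ω, q)| ≤ c) → S ω = t := by
  let f : X → ℝ≥0 → ℝ := fun ω t => |Z (ω, t) - Z (ω, q)|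
  have hfr : ∀ ω t, Tendsto (f ω) (𝓝[≥] t) (𝓝 (f ω t)) := fun ω t =>
    (((hZ ω).1 t).sub_const _).abs
  let E : Set (X × ℝ≥0) := {p | q < p.2 ∧ (c : ℝ) < f p.1 p.2 ∧
    ∀ k, (q < dsq k ∧ dsq k < p.2) → f p.1 (dsq k) ≤ c}
  have hsnd := (snd_pred G).mono h1 le_rfl
  have hE : MeasurableSet[Λ] E := by
    have e1 : MeasurableSet[Λ] {p : X × ℝ≥0 | q < p.2} := hsnd measurableSet_Ioi
    have hzq : Measurable[Λ] fun p : X × ℝ≥0 => if q < p.2 then Z (p.1, q) else 0 := by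
      refine Measurable.mono (ma := predSF G) ?_ h1 le_rfl
      intro B hB
      have : ((fun p : X × ℝ≥0 => if q < p.2 then Z (p.1, q) else 0) ⁻¹' B) =
        {p : X × ℝ≥0 | p.1 ∈ {ω | Z (ω, q) ∈ B} ∧ q < p.2} ∪
          ((fun p : X × ℝ≥0 => p.2) ⁻¹' {t | ¬ q < t ∧ (0:ℝ) ∈ B}) := by
        ext p
        simp only [mem_preimage, mem_union, mem_ofPred_eq]
        by_cases h : q < p.2 <;> simp [h]
      rw [this]
      refine MeasurableSet.union (rect_pred hG _ (hZa q hB)) (snd_pred G ?_)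
      by_cases h0 : (0:ℝ) ∈ B
      · simp only [h0, and_true, not_lt]; exact measurableSet_Iic
      · simp [h0]
    have e2 : MeasurableSet[Λ] {p : X × ℝ≥0 | (c : ℝ) < |Z p - if q < p.2 then Z (p.1, q) else 0|} :=
      (continuous_abs.measurable.comp (hZm.sub hzq)) measurableSet_Ioi
    have e3 : ∀ k, MeasurableSet[Λ] {p : X × ℝ≥0 | (q < dsq k ∧ dsq k < p.2) → f p.1 (dsq k) ≤ c} := by
      intro k
      by_cases hk : q < dsq k
      · have hm : MeasurableSet[G (dsq k)] {ω | c < f ω (dsq k)} := by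
          have : Measurable[G (dsq k)] fun ω => f ω (dsq k) :=
            continuous_abs.measurable.comp ((hZa (dsq k)).sub ((hZa q).mono (hG hk.le) le_rfl))
          exact this measurableSet_Ioi
        have h4 := (h1 _ (rect_pred hG _ hm)).compl
        convert h4 using 1
        ext p
        simp only [hk, true_and, mem_ofPred_eq, mem_compl_iff, not_and, not_lt]
        constructor
        · intro h h5
          by_contra h6
          exact absurd (h (not_le.1 h6)) (not_le.2 h5)
        · intro h h5
          by_contra h6
          exact absurd (h (not_le.1 h6)) (not_le.2 h5)
      · simp [hk]
    have : E = {p : X × ℝ≥0 | q < p.2} ∩ ({p : X × ℝ≥0 | (c : ℝ) < |Z p - if q < p.2 then Z (p.1, q) else 0|} ∩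
      ⋂ k, {p : X × ℝ≥0 | (q < dsq k ∧ dsq k < p.2) → f p.1 (dsq k) ≤ c}) := by
      ext p
      simp only [E, f, mem_ofPred_eq, mem_inter_iff, mem_iInter]
      refine and_congr_right fun h => ?_
      rw [if_pos h]
    rw [this]
    exact e1.inter (e2.inter (MeasurableSet.iInter e3))
  have hlt : ∀ ω s t, (ω, s) ∈ E → (ω, t) ∈ E → ¬ s < t := by
    rintro ω s t ⟨h1, h2, -⟩ ⟨-, -, h3⟩ hst
    have hev := (hfr ω s).eventually_const_lt h2
    obtain ⟨u, hu, hu2⟩ := (mem_nhdsGE_iff_exists_Ico_subset' hst).1 hev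
    have hu : s < u := hu
    obtain ⟨b, hb1, hb2⟩ := dsq_btwn (lt_min hu hst)
    have h4 : (c : ℝ) < f ω (dsq b) := hu2 ⟨hb1.le, hb2.trans_le (min_le_left _ _)⟩
    exact absurd (h3 b ⟨lt_trans h1 hb1, hb2.trans_le (min_le_right _ _)⟩) (not_le.2 h4)
  obtain ⟨S, hS1, hS2⟩ := graph_stop hG h1 hE
    (fun ω s t hs ht => le_antisymm (not_lt.1 (hlt ω t s ht hs)) (not_lt.1 (hlt ω s t hs ht))) (by
      intro n
      have heq : {ω | ∃ t < dsq n, (ω, t) ∈ E} = {ω | Form q c (dsq n) (f ω)} := by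
        ext ω
        simp only [mem_ofPred_eq]
        rw [← form_iff (hfr ω) (by simp [f])]
        rfl
      rw [heq]
      rcases le_or_gt (dsq n) q with hq | hq
      · have : {ω | Form q c (dsq n) (f ω)} = ∅ := by
          ext ω
          simp only [mem_ofPred_eq, mem_empty_iff_false, iff_false]
          rintro ⟨m, a, h1, ⟨b, ⟨h2, h3⟩, -⟩, -⟩
          exact absurd (h2.trans (h3.trans h1)) (not_lt.2 hq)
        rw [this]; exact @MeasurableSet.empty _ (G (dsq n))
      · refine @form_meas X (G (dsq n)) _ _ _ _ fun t ht => ?_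
        exact continuous_abs.measurable.comp (((hZa t).mono (hG ht.le) le_rfl).sub ((hZa q).mono (hG hq.le) le_rfl)))
  exact ⟨S, hS1, fun ω t h1 h2 h3 => hS2 ω t ⟨h1, h2, fun k hk => h3 _ hk.1 hk.2⟩⟩

def Thin {X : Type*} (Λ : MeasurableSpace (X × ℝ≥0)) (N : Set (X × ℝ≥0)) : Prop :=
  ∃ S : ℕ → X → ℝ≥0∞, (∀ n, IsStoppingTimeM Λ (S n)) ∧ ∀ ω (t : ℝ≥0), (ω, t) ∈ N → ∃ n, S n ω = t

theorem Thin.mono {X : Type*} {Λ : MeasurableSpace (X × ℝ≥0)} {N M : Set (X × ℝ≥0)}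
    (h : Thin Λ M) (hNM : N ⊆ M) : Thin Λ N := by
  obtain ⟨S, h1, h2⟩ := h
  exact ⟨S, h1, fun ω t h => h2 ω t (hNM h)⟩

theorem thin_iUnion {X : Type*} {Λ : MeasurableSpace (X × ℝ≥0)} {N : ℕ → Set (X × ℝ≥0)}
    (h : ∀ n, Thin Λ (N n)) : Thin Λ (⋃ n, N n) := by
  choose S h1 h2 using h
  refine ⟨fun n => S (Nat.unpair n).1 (Nat.unpair n).2, fun n => h1 _ _, fun ω t h => ?_⟩
  obtain ⟨k, hk⟩ := mem_iUnion.1 h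
  obtain ⟨j, hj⟩ := h2 k ω t hk
  exact ⟨Nat.pair k j, by simpa using hj⟩

theorem jumps_thin {X : Type*} {G : ℝ≥0 → MeasurableSpace X} (hG : Monotone G)
    {Λ : MeasurableSpace (X × ℝ≥0)} (h1 : predSF G ≤ Λ)
    {Z : X × ℝ≥0 → ℝ} (hZ : ∀ ω, IsCadlag fun t => Z (ω, t)) (hZa : Adapted' G Z)
    (hZm : Measurable[Λ] Z) :
    ∃ W : X × ℝ≥0 → ℝ, Measurable[predSF G] W ∧ Thin Λ {p | Z p ≠ W p} := by
  obtain ⟨W, hW, hW0, hWl⟩ := leftlim_pred hG hZ hZa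
  refine ⟨W, hW, ?_⟩
  choose S hS1 hS2 using fun q c => exit_stop hG h1 hZ hZa hZm q c
  refine (thin_iUnion (N := fun i => ⋃ j : ℕ,
    {p | S (dsq i) (1 / ((j : ℝ≥0) + 1)) p.1 = p.2}) fun i => thin_iUnion fun j =>
    ⟨fun _ => S (dsq i) (1 / ((j : ℝ≥0) + 1)), fun _ => hS1 _ _, fun ω t h => ⟨0, h⟩⟩).mono ?_
  rintro ⟨ω, t⟩ hne
  have hne : Z (ω, t) ≠ W (ω, t) := hne
  rcases eq_or_ne t 0 with rfl | ht
  · exact absurd (hW0 ω).symm hne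
  have ht : 0 < t := pos_iff_ne_zero.2 ht
  have hδ : 0 < |Z (ω, t) - W (ω, t)| / 2 := by
    have := abs_pos.2 (sub_ne_zero.2 hne); linarith
  obtain ⟨j, hj⟩ := exists_nat_one_div_lt hδ
  have hjp : (0:ℝ) < 1 / ((j : ℝ) + 1) := by positivity
  have hev := Metric.tendsto_nhds.1 (hWl ω t ht) (1 / ((j : ℝ) + 1) / 2) (by positivity)
  obtain ⟨a, ha, ha2⟩ := (mem_nhdsLT_iff_exists_Ioo_subset' ht).1 hev
  have ha : a < t := ha
  obtain ⟨i, hi1, hi2⟩ := dsq_btwn ha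
  have hcl : ∀ s, a < s → s < t → |Z (ω, s) - W (ω, t)| < 1 / ((j : ℝ) + 1) / 2 := by
    intro s h1 h2
    have := ha2 ⟨h1, h2⟩
    simpa [Real.dist_eq] using this
  have hq := hcl _ hi1 hi2
  simp only [mem_iUnion, mem_ofPred_eq]
  refine ⟨i, j, hS2 _ _ ω t hi2 ?_ ?_⟩
  · push_cast
    have := abs_sub_le (Z (ω, t)) (Z (ω, dsq i)) (W (ω, t))
    linarith
  · intro s h1 h2
    push_cast
    have h3 := hcl s (hi1.trans h1) h2
    have := abs_sub_le (Z (ω, s)) (W (ω, t)) (Z (ω, dsq i))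
    rw [abs_sub_comm (W (ω, t))] at this
    linarith

theorem set_thin {X : Type*} {G : ℝ≥0 → MeasurableSpace X} (hG : Monotone G)
    {Λ : MeasurableSpace (X × ℝ≥0)} (h1 : predSF G ≤ Λ) (h2 : Λ ≤ optSF G)
    {𝒞 : Set (X × ℝ≥0 → ℝ)} (hC : ∀ Z ∈ 𝒞, ∀ ω, IsCadlag fun t => Z (ω, t)) (hΛ : Λ = genBy 𝒞)
    {A : Set (X × ℝ≥0)} (hA : MeasurableSet[Λ] A) :
    ∃ A', MeasurableSet[predSF G] A' ∧ Thin Λ {p | ¬ (p ∈ A ↔ p ∈ A')} := by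
  let m' : MeasurableSpace (X × ℝ≥0) :=
    { MeasurableSet' := fun A => ∃ A', MeasurableSet[predSF G] A' ∧ Thin Λ {p | ¬ (p ∈ A ↔ p ∈ A')}
      measurableSet_empty := by
        refine ⟨∅, @MeasurableSet.empty _ (predSF G), fun _ _ => ∞, fun n => ?_, by simp⟩
        simp [IsStoppingTimeM]
      measurableSet_compl := by
        rintro s ⟨A', h, ht⟩
        refine ⟨A'ᶜ, h.compl, ht.mono fun p hp => ?_⟩
        simp only [mem_ofPred_eq, mem_compl_iff] at hp ⊢
        tauto
      measurableSet_iUnion := by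
        intro s hs
        choose A' h ht using hs
        refine ⟨⋃ n, A' n, MeasurableSet.iUnion h, (thin_iUnion ht).mono fun p hp => ?_⟩
        by_contra hcon
        simp only [mem_iUnion, mem_ofPred_eq, not_exists, not_not] at hp hcon
        exact hp (exists_congr hcon) }
  suffices h : Λ ≤ m' from h A hA
  have hgen : ∀ Z ∈ 𝒞, Measurable[m'] Z := by
    intro Z hZ B hB
    have hZm : Measurable[Λ] Z := by rw [hΛ]; exact genBy_meas hZ
    have hZa : Adapted' G Z := fun t => (hZm.mono h2 le_rfl).comp (sect_opt G t)
    obtain ⟨W, hW, hth⟩ := jumps_thin hG h1 (hC Z hZ) hZa hZm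
    refine ⟨W ⁻¹' B, hW hB, hth.mono fun p hp => ?_⟩
    simp only [mem_ofPred_eq, mem_preimage] at hp ⊢
    intro h
    rw [h] at hp
    exact hp Iff.rfl
  rw [hΛ]
  exact iSup₂_le fun Z hZ => measurable_iff_comap_le.1 (hgen Z hZ)

theorem fun_thin {X : Type*} {G : ℝ≥0 → MeasurableSpace X} (hG : Monotone G)
    {Λ : MeasurableSpace (X × ℝ≥0)} (h1 : predSF G ≤ Λ) (h2 : Λ ≤ optSF G)
    {𝒞 : Set (X × ℝ≥0 → ℝ)} (hC : ∀ Z ∈ 𝒞, ∀ ω, IsCadlag fun t => Z (ω, t)) (hΛ : Λ = genBy 𝒞)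
    {C : X × ℝ≥0 → ℝ} (hCm : Measurable[Λ] C) :
    ∃ C', Measurable[predSF G] C' ∧ Thin Λ {p | C p ≠ C' p} := by
  obtain ⟨u, hu⟩ := exists_surjective_nat ℚ
  have := fun n => set_thin hG h1 h2 hC hΛ (A := {p | (u n : ℝ) < C p}) (hCm measurableSet_Ioi)
  choose A' hA' hth using this
  refine ⟨fun p => (⨆ n, if p ∈ A' n then ((u n : ℝ) : EReal) else ⊥).toReal, ?_, ?_⟩
  · refine measurable_ereal_toReal.comp ?_
    exact Measurable.iSup fun n => Measurable.ite (hA' n) measurable_const measurable_const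
  · refine (thin_iUnion hth).mono fun p hp => ?_
    by_contra hcon
    simp only [mem_iUnion, mem_ofPred_eq, not_exists, not_not] at hcon
    apply hp
    have : (⨆ n, if p ∈ A' n then ((u n : ℝ) : EReal) else ⊥) = (C p : EReal) := by
      apply le_antisymm
      · refine iSup_le fun n => ?_
        split_ifs with h
        · exact EReal.coe_le_coe_iff.2 ((hcon n).2 h).le
        · exact bot_le
      · refine le_of_forall_lt fun x hx => ?_
        obtain ⟨r, hr1, hr2⟩ := EReal.lt_iff_exists_rat_btwn.1 hx
        obtain ⟨n, rfl⟩ := hu r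
        refine hr1.trans_le (le_iSup_of_le n ?_)
        have hin : p ∈ A' n := (hcon n).1 (by exact_mod_cast hr2)
        rw [if_pos hin]
    simp only [this, EReal.toReal_coe]

theorem stop_meas {X : Type*} [mX : MeasurableSpace X] {Λ : MeasurableSpace (X × ℝ≥0)}
    (hle : Λ ≤ @Prod.instMeasurableSpace X ℝ≥0 mX inferInstance) {S : X → ℝ≥0∞}
    (hS : IsStoppingTimeM Λ S) : Measurable S := by
  refine measurable_of_Iic fun x => ?_
  induction x with
  | top => simp
  | coe t => exact measurable_prodMk_right (y := t) (hle _ hS)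

theorem evalH {X : Type*} {Λ : MeasurableSpace (X × ℝ≥0)} {V : X × ℝ≥0 → ℝ}
    (hV : Measurable[Λ] V) {S : X → ℝ≥0∞} (hS : ∀ ω, S ω < ∞) :
    Measurable[sigmaAtTime Λ S] (EvalAtF V S) := by
  refine genBy_meas ⟨fun p => if p.2 = ∞ then 0 else V (p.1, p.2.toNNReal), ⟨?_, ?_⟩, ?_⟩
  · simpa using hV
  · simp only [if_true]
    exact @measurable_const _ _ _ (sigmaInf Λ) _
  · funext ω
    simp [EvalAtF, (hS ω).ne]

theorem sigmaAtTime_le {X : Type*} [mX : MeasurableSpace X] {Λ : MeasurableSpace (X × ℝ≥0)}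
    (hle : Λ ≤ @Prod.instMeasurableSpace X ℝ≥0 mX inferInstance) {S : X → ℝ≥0∞}
    (hS : Measurable S) (hSf : ∀ ω, S ω < ∞) : sigmaAtTime Λ S ≤ mX := by
  refine iSup₂_le ?_
  rintro f ⟨Z, hZ, rfl⟩
  rw [← measurable_iff_comap_le]
  have h1 := hZ.1.mono hle le_rfl
  have h2 : @Measurable X (X × ℝ≥0) mX (@Prod.instMeasurableSpace X ℝ≥0 mX inferInstance)
      fun ω => (ω, (S ω).toNNReal) := measurable_id.prodMk hS.ennreal_toNNReal
  have h3 := h1.comp h2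
  convert h3 using 1
  funext ω
  simp [ENNReal.coe_toNNReal (hSf ω).ne]

theorem proj_eq {X : Type*} [mX : MeasurableSpace X] (P : Measure X) [IsProbabilityMeasure P]
    {G : ℝ≥0 → MeasurableSpace X}
    (hle : predSF G ≤ @Prod.instMeasurableSpace X ℝ≥0 mX inferInstance)
    {C C' pC : X × ℝ≥0 → ℝ} (hCb : ∃ K : ℝ, ∀ p, |C p| ≤ K) (hCm : Measurable C)
    (hC' : Measurable[predSF G] C') (hpC : IsPredProjF P G C pC)
    {S : X → ℝ≥0∞} (hS : IsStoppingTimeM (predSF G) S)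
    (hCC : ∀ᵐ ω ∂P, S ω < ∞ → C (ω, (S ω).toNNReal) = C' (ω, (S ω).toNNReal)) :
    ∀ᵐ ω ∂P, S ω < ∞ → pC (ω, (S ω).toNNReal) = C' (ω, (S ω).toNNReal) := by
  have key : ∀ N : ℕ, ∀ᵐ ω ∂P, S ω ≤ N → pC (ω, (S ω).toNNReal) = C' (ω, (S ω).toNNReal) := by
    intro N
    let τ : X → ℝ≥0∞ := fun ω => min (S ω) N
    have hτ : IsStoppingTimeM (predSF G) τ := by
      have : {p : X × ℝ≥0 | τ p.1 ≤ p.2} = {p : X × ℝ≥0 | S p.1 ≤ p.2} ∪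
          (fun p : X × ℝ≥0 => p.2) ⁻¹' (Ici (N : ℝ≥0)) := by
        ext p
        simp only [τ, mem_ofPred_eq, min_le_iff, mem_union, mem_preimage, mem_Ici]
        refine or_congr Iff.rfl ?_
        norm_cast
      unfold IsStoppingTimeM
      rw [this]
      exact MeasurableSet.union hS (snd_pred G measurableSet_Ici)
    have hτf : ∀ ω, τ ω < ∞ := fun ω => (min_le_right _ _).trans_lt (ENNReal.natCast_lt_top N)
    have hτm : Measurable τ := stop_meas hle hτ
    have hH := sigmaAtTime_le hle hτm hτf
    have hp := hpC.2 τ hτ hτf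
    have hBm : MeasurableSet[sigmaAtTime (predSF G) τ] {ω | S ω ≤ N} := by
      have hV : Measurable[predSF G] ({p : X × ℝ≥0 | S p.1 ≤ p.2}.indicator fun _ => (1:ℝ)) :=
        measurable_const.indicator hS
      have h3 := evalH hV hτf (measurableSet_singleton (1:ℝ))
      convert h3 using 1
      ext ω
      simp only [EvalAtF, mem_ofPred_eq, mem_preimage, mem_singleton_iff, Set.indicator_apply,
        ENNReal.coe_toNNReal (hτf ω).ne]
      simp [τ]
    have hint : Integrable (EvalAtF C τ) P := by
      obtain ⟨K, hK⟩ := hCb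
      have : Measurable (EvalAtF C τ) := hCm.comp (measurable_id.prodMk hτm.ennreal_toNNReal)
      exact Integrable.of_bound this.aestronglyMeasurable K (Eventually.of_forall fun ω => hK _)
    have e1 := condExp_indicator hint hBm
    have e2 : {ω | S ω ≤ N}.indicator (EvalAtF C τ) =ᵐ[P] {ω | S ω ≤ N}.indicator (EvalAtF C' τ) := by
      filter_upwards [hCC] with ω hω
      by_cases hb : S ω ≤ N
      · have : τ ω = S ω := min_eq_left hb
        simp only [Set.indicator_apply, mem_ofPred_eq, hb, if_true, EvalAtF, this]
        exact hω (hb.trans_lt (ENNReal.natCast_lt_top N))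
      · simp [Set.indicator_apply, hb]
    have hint' : Integrable ({ω | S ω ≤ N}.indicator (EvalAtF C' τ)) P :=
      (hint.indicator (hH _ hBm)).congr e2
    have hsm : StronglyMeasurable[sigmaAtTime (predSF G) τ] ({ω | S ω ≤ N}.indicator (EvalAtF C' τ)) :=
      ((evalH hC' hτf).indicator hBm).stronglyMeasurable
    have e3 := condExp_congr_ae (m := sigmaAtTime (predSF G) τ) e2
    rw [condExp_of_stronglyMeasurable hH hsm hint'] at e3
    filter_upwards [e1, e3, hp] with ω h1 h2 h3 hb
    have ht : τ ω = S ω := min_eq_left hb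
    rw [h1] at h2
    simp only [Set.indicator_apply, mem_ofPred_eq, hb, if_true] at h2
    rw [← h3] at h2
    simpa only [EvalAtF, ht] using h2
  filter_upwards [ae_all_iff.2 key] with ω h hlt
  obtain ⟨N, hN⟩ := ENNReal.exists_nat_gt hlt.ne
  exact h N hN.le

/-- At a totally `Λ`-inaccessible stopping time, a bounded
`Λ`-measurable process agrees a.s. with its predictable projection. -/
theorem statement6 (P : Measure Ω) [IsProbabilityMeasure P] [hPc : P.IsComplete]
    (Λ : MeasurableSpace (Ω × ℝ≥0)) (hΛ : IsMeyer mΩ Λ) (hcomp : IsPCompleteM P Λ)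
    (G : ℝ≥0 → MeasurableSpace Ω) (hG : UsualConditions P G)
    (h1 : predSF G ≤ Λ) (h2 : Λ ≤ optSF G)
    (C : Ω × ℝ≥0 → ℝ) (hCb : ∃ K : ℝ, ∀ p, |C p| ≤ K) (hCm : Measurable[Λ] C)
    (pC : Ω × ℝ≥0 → ℝ) (hpC : IsPredProjF P G C pC)
    (T : Ω → ℝ≥0∞) (hT : IsStoppingTimeCl G T) (hTi : IsTotallyInaccessibleM P Λ T) :
    ∀ᵐ ω ∂P, T ω < ∞ → C (ω, (T ω).toNNReal) = pC (ω, (T ω).toNNReal) := by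
  obtain ⟨𝒞, hC, hgen⟩ := hΛ.gen_cadlag
  have hmono := hG.1
  have hpp : predSF G ≤ @Prod.instMeasurableSpace Ω ℝ≥0 mΩ inferInstance := h1.trans hΛ.le_prod
  have hlam : ∀ {R}, IsStoppingTimeM (predSF G) R → IsStoppingTimeM Λ R := fun h => h1 _ h
  have hTm : Measurable T := by
    refine measurable_of_Iic fun x => ?_
    induction x with
    | top => simp
    | coe t => exact hG.2.1 t _ (hT t)
  obtain ⟨C', hC', S, hS1, hS2⟩ := fun_thin hmono h1 h2 hC hgen hCm
  have hSm : ∀ n, Measurable (S n) := fun n => stop_meas hΛ.le_prod (hS1 n)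
  have hex : ∀ n, ∃ R : ℕ → Ω → ℝ≥0∞, (∀ k, IsStoppingTimeM (predSF G) (R k)) ∧
      ∀ R', IsStoppingTimeM (predSF G) R' →
        P ({ω | R' ω = S n ω ∧ S n ω < ∞} \ ⋃ k, {ω | R k ω = S n ω ∧ S n ω < ∞}) = 0 := by
    intro n
    obtain ⟨u, hu, hu2⟩ := exhaust P
      {s | ∃ R, IsStoppingTimeM (predSF G) R ∧ s = {ω | R ω = S n ω ∧ S n ω < ∞}} (by
        rintro s ⟨R, hR, rfl⟩
        exact (measurableSet_eq_fun (stop_meas hpp hR) (hSm n)).inter (hSm n measurableSet_Iio))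
      ⟨_, fun _ => ∞, by simp [IsStoppingTimeM], rfl⟩
    choose R hR hR2 using hu
    refine ⟨R, hR, fun R' hR' => ?_⟩
    have := hu2 _ ⟨R', hR', rfl⟩
    simpa only [hR2] using this
  choose R hR hRex using hex
  let A : Set (Ω × ℝ≥0) := {p | pC p ≠ C' p} \ ⋃ n, ⋃ k, {p | R n k p.1 = p.2}
  have hA : MeasurableSet[predSF G] A := by
    refine MeasurableSet.diff ?_ (MeasurableSet.iUnion fun n => MeasurableSet.iUnion fun k =>
      graph_pred hmono (hR n k))
    have h3 : MeasurableSet[predSF G] ((fun p => pC p - C' p) ⁻¹' {0}ᶜ) :=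
      (hpC.1.sub hC') (measurableSet_singleton (0:ℝ)).compl
    convert h3 using 1
    ext p
    simp [sub_eq_zero]
  have hA0 : P {ω | T ω < ∞ ∧ (ω, (T ω).toNNReal) ∈ A} = 0 := by
    by_contra hpos
    obtain ⟨S0, hS0, hS0A, hS0p⟩ := pred_section P hmono hpp hTm hA hpos
    have hn : ∀ n, ∀ᵐ ω ∂P, ¬ (S0 ω = S n ω ∧ S n ω < ∞) := by
      intro n
      refine measure_mono_null ?_ (hRex n S0 hS0)
      intro ω hω
      have hω : S0 ω = S n ω ∧ S n ω < ∞ := not_not.1 hω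
      refine ⟨hω, fun hin => ?_⟩
      obtain ⟨k, hk⟩ := mem_iUnion.1 hin
      have hk : R n k ω = S n ω ∧ S n ω < ∞ := hk
      have ht := ENNReal.coe_toNNReal hω.2.ne
      have hmem := hS0A ω (S n ω).toNNReal (by rw [ht]; exact hω.1)
      refine hmem.2 (mem_iUnion.2 ⟨n, mem_iUnion.2 ⟨k, ?_⟩⟩)
      change R n k ω = ((S n ω).toNNReal : ℝ≥0∞)
      rw [ht]; exact hk.1
    have hCC : ∀ᵐ ω ∂P, S0 ω < ∞ → C (ω, (S0 ω).toNNReal) = C' (ω, (S0 ω).toNNReal) := by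
      filter_upwards [ae_all_iff.2 hn] with ω h hlt
      by_contra hne
      obtain ⟨n, hn⟩ := hS2 ω _ hne
      rw [ENNReal.coe_toNNReal hlt.ne] at hn
      exact h n ⟨hn.symm, by rw [hn]; exact hlt⟩
    have := proj_eq P hpp hCb (hCm.mono hΛ.le_prod le_rfl) hC' hpC hS0 hCC
    apply hS0p
    refine measure_mono_null ?_ this
    intro ω hω hcon
    have hω : S0 ω < ∞ := hω
    exact (hS0A ω _ (ENNReal.coe_toNNReal hω.ne).symm).1 (hcon hω)
  have hT1 : ∀ n, ∀ᵐ ω ∂P, ¬ (S n ω = T ω ∧ T ω < ∞) := fun n => by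
    refine measure_mono_null ?_ (hTi (S n) (hS1 n))
    intro ω hω; exact not_not.1 hω
  have hT2 : ∀ n k, ∀ᵐ ω ∂P, ¬ (R n k ω = T ω ∧ T ω < ∞) := fun n k => by
    refine measure_mono_null ?_ (hTi (R n k) (hlam (hR n k)))
    intro ω hω; exact not_not.1 hω
  have hT3 : ∀ᵐ ω ∂P, ¬ (T ω < ∞ ∧ (ω, (T ω).toNNReal) ∈ A) := by
    refine measure_mono_null ?_ hA0
    intro ω hω; exact not_not.1 hω
  filter_upwards [ae_all_iff.2 hT1, ae_all_iff.2 fun n => ae_all_iff.2 (hT2 n), hT3] with ω a1 a2 a3 hlt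
  have ht := ENNReal.coe_toNNReal hlt.ne
  have b1 : C (ω, (T ω).toNNReal) = C' (ω, (T ω).toNNReal) := by
    by_contra hne
    obtain ⟨n, hn⟩ := hS2 ω _ hne
    rw [ht] at hn
    exact a1 n ⟨hn, hlt⟩
  have b2 : pC (ω, (T ω).toNNReal) = C' (ω, (T ω).toNNReal) := by
    by_contra hne
    refine a3 ⟨hlt, hne, fun hin => ?_⟩
    obtain ⟨n, hn⟩ := mem_iUnion.1 hin
    obtain ⟨k, hk⟩ := mem_iUnion.1 hn
    have hk : R n k ω = ((T ω).toNNReal : ℝ≥0∞) := hk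
    rw [ht] at hk
    exact a2 n k ⟨hk, hlt⟩
  rw [b1, b2]

end Meyer
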